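/- Let λ : ℕ → [0,∞) be a sequence, let m : [0,∞) → [0,∞) satisfy m(x) ≥ μ₁ > 0 for every x ≥ 0 and |m(a) − m(b)| ≤ ω_m(|a−b|) for all a,b ≥ 0, where ω_m is a continuity modulus. Let σ ∈ (0,1/2] and δ > 0, and let α ∈ [0,1/4) satisfy limsup_{x→0⁺} (ω_m(x))^{4α} / x^{1−2σ} < +∞. Let ω_d be a continuity modulus with ω_d(1) = 1, ω_d(x) ≤ x^{4α} for every x ≥ 0, and lim_{x→0⁺} ω_d(x)/x^{4α} = 0, and let (u⁰,u¹) ∈ V_{ω_d}. Then there exists T > 0 and a solution u on [0,T] of the Kirchhoff equation u'' + 2δ A^σ u' + m(|A^{1/2}u|²) A u = 0 with initial data (u⁰,u¹), belonging to C⁰([0,T], D(A^{1/2})) ∩ C¹([0,T], H), such that moreover (u(t),u'(t)) ∈ V_{ω_d} for every t ∈ [0,T] and the curves t ↦ ((ω_d(1/λ_k))^{−1/2} λ_k u_k(t))_{k : λ_k>0} and t ↦ ((ω_d(1/λ_k))^{−1/2} u_k'(t))_{k : λ_k>0} are continuous with values in ℓ². -/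

import Mathlib

open Set Filter MeasureTheory Topology

noncomputable section

/-- A continuity modulus: continuous on `[0,∞)`, vanishing at `0`, positive for positive
arguments, nondecreasing, and such that `x ↦ x / ω x` is nondecreasing on `(0,∞)`. -/
def IsModulus (ω : ℝ → ℝ) : Prop :=
  ContinuousOn ω (Ici 0) ∧ ω 0 = 0 ∧ (∀ x : ℝ, 0 < x → 0 < ω x) ∧
  (∀ x y : ℝ, 0 ≤ x → x ≤ y → ω x ≤ ω y) ∧
  (∀ x y : ℝ, 0 < x → x ≤ y → x / ω x ≤ y / ω y)

/-- The curve `t ↦ (v t k)_k` takes values in `ℓ²` and is continuous on `I`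
with respect to the `ℓ²` norm. -/
def L2Cont (I : Set ℝ) (v : ℝ → ℕ → ℝ) : Prop :=
  (∀ t ∈ I, Summable fun k => (v t k) ^ 2) ∧
  ∀ t ∈ I, ∀ ε : ℝ, 0 < ε → ∃ η > (0:ℝ), ∀ s ∈ I, |s - t| < η →
    (∑' k, (v s k - v t k) ^ 2) < ε

/-- A solution on the interval `I` (which contains `0`) of the Kirchhoff equation
`u'' + 2δ A^σ u' + m(|A^{1/2}u|²) A u = 0` with initial data `(u0, u1)`, in the diagonal
setting where `A` multiplies the `k`-th component by `lam k ^ 2`.  Each component is `C²`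
on `I`, satisfies the componentwise ODE, and the curves `t ↦ u(t)`, `t ↦ A^{1/2}u(t)`,
`t ↦ u'(t)` are continuous with values in `ℓ²`. -/
def IsKirchhoffSol (lam : ℕ → ℝ) (m : ℝ → ℝ) (σ δ : ℝ) (I : Set ℝ)
    (u0 u1 : ℕ → ℝ) (u : ℕ → ℝ → ℝ) : Prop :=
  (∀ k, ContDiffOn ℝ 2 (u k) I) ∧
  (∀ k, u k 0 = u0 k) ∧
  (∀ k, derivWithin (u k) I 0 = u1 k) ∧
  (∀ k, ∀ t ∈ I,
    derivWithin (derivWithin (u k) I) I t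
      + 2 * δ * lam k ^ (2 * σ) * derivWithin (u k) I t
      + m (∑' j, lam j ^ 2 * u j t ^ 2) * lam k ^ 2 * u k t = 0) ∧
  L2Cont I (fun t k => u k t) ∧
  L2Cont I (fun t k => lam k * u k t) ∧
  L2Cont I (fun t k => derivWithin (u k) I t)

/-- The `k`-th summand of the squared seminorm `‖(u0,u1)‖_{ωd}²` of the interpolation
space `V_{ωd}`: it equals `((u1 k)² + (lam k)² (u0 k)²) / ωd (1 / lam k)` when
`lam k > 0`, and `0` otherwise. -/
def Vsum (lam : ℕ → ℝ) (ωd : ℝ → ℝ) (u0 u1 : ℕ → ℝ) (k : ℕ) : ℝ :=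
  if 0 < lam k then (u1 k ^ 2 + lam k ^ 2 * u0 k ^ 2) / ωd (1 / lam k) else 0

/-- Membership in the interpolation space `V_{ωd}` (inside `D(A^{1/2}) × H`). -/
def MemV (lam : ℕ → ℝ) (ωd : ℝ → ℝ) (u0 u1 : ℕ → ℝ) : Prop :=
  (Summable fun k => u0 k ^ 2) ∧ (Summable fun k => lam k ^ 2 * u0 k ^ 2) ∧
  (Summable fun k => u1 k ^ 2) ∧ Summable (Vsum lam ωd u0 u1)

/-- The curve `t ↦ (u(t), u'(t))` lies in `V_{ωd}` for every `t ∈ I` and the weighted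
curves `t ↦ ((ωd(1/λ_k))^{-1/2} λ_k u_k(t))_k` and `t ↦ ((ωd(1/λ_k))^{-1/2} u_k'(t))_k`
(over `k` with `λ_k > 0`) are continuous with values in `ℓ²`. -/
def VRegCurves (lam : ℕ → ℝ) (ωd : ℝ → ℝ) (I : Set ℝ) (u : ℕ → ℝ → ℝ) : Prop :=
  (∀ t ∈ I, Summable (Vsum lam ωd (fun k => u k t) (fun k => derivWithin (u k) I t))) ∧
  L2Cont I (fun t k =>
    if 0 < lam k then lam k * u k t / Real.sqrt (ωd (1 / lam k)) else 0) ∧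
  L2Cont I (fun t k =>
    if 0 < lam k then derivWithin (u k) I t / Real.sqrt (ωd (1 / lam k)) else 0)

/-- `(u, v)` solves `u' = v`, `v' = -b v - c l² u` on `[0, 1]` with data `(p, q)` at time `0`. -/
structure IsModeSol (c : ℝ → ℝ) (b l p q : ℝ) (u v : ℝ → ℝ) : Prop where
  u_zero : u 0 = p
  v_zero : v 0 = q
  hasDerivAt_u : ∀ t ∈ Icc (0 : ℝ) 1, HasDerivAt u (v t) t
  hasDerivAt_v : ∀ t ∈ Icc (0 : ℝ) 1, HasDerivAt v (-(b * v t) - c t * l ^ 2 * u t) t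

lemma abs_clip_sub_le (R x y : ℝ) : |max (-R) (min R x) - max (-R) (min R y)| ≤ |x - y| := by
  have h := abs_min_sub_min_le_max R x R y
  have h2 := abs_max_sub_max_le_max (-R) (min R x) (-R) (min R y)
  simp only [sub_self, abs_zero, abs_nonneg, sup_of_le_right] at h h2
  exact h2.trans h

lemma abs_clip_le {R : ℝ} (hR : 0 ≤ R) (x : ℝ) : |max (-R) (min R x)| ≤ R := by
  rw [abs_le]
  exact ⟨le_max_left _ _, max_le (by linarith) (min_le_left _ _)⟩

lemma abs_clip_le_abs {R : ℝ} (hR : 0 ≤ R) (x : ℝ) : |max (-R) (min R x)| ≤ |x| := by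
  have h := abs_clip_sub_le R x 0
  simpa [hR] using h

lemma clip_eq_self {R x : ℝ} (hx : |x| ≤ R) : max (-R) (min R x) = x := by
  rw [abs_le] at hx
  rw [min_eq_right hx.2, max_eq_right hx.1]

lemma exists_isModeSol {c : ℝ → ℝ} (hc : Continuous c) (b l p q : ℝ) :
    ∃ u v : ℝ → ℝ, IsModeSol c b l p q u v := by
  obtain ⟨B, hB⟩ := isCompact_Icc.exists_bound_of_continuousOn
    (s := Icc (-1 : ℝ) 2) hc.continuousOn
  have hB0 : 0 ≤ B := (norm_nonneg _).trans (hB 0 (by norm_num))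
  set K : ℝ := 1 + |b| + B * l ^ 2 with hK
  have hK0 : 0 ≤ K := by positivity
  set R : ℝ := ‖((p, q) : ℝ × ℝ)‖ * Real.exp K with hR
  have hR0 : 0 ≤ R := by positivity
  let f : ℝ → ℝ × ℝ → ℝ × ℝ := fun t x =>
    (max (-R) (min R x.2), -(b * max (-R) (min R x.2)) - c t * l ^ 2 * max (-R) (min R x.1))
  have key : ∀ t ∈ Icc (-1 : ℝ) 2, ∀ y z M : ℝ, |y| ≤ M → |z| ≤ M →
      ‖((z, -(b * z) - c t * l ^ 2 * y) : ℝ × ℝ)‖ ≤ K * M := by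
    intro t ht y z M hy hz
    have hM : 0 ≤ M := (abs_nonneg _).trans hy
    have hct : |c t| ≤ B := hB t ht
    rw [Prod.norm_def]
    refine max_le ?_ ?_
    · rw [Real.norm_eq_abs]
      have : 0 ≤ (|b| + B * l ^ 2) * M := by positivity
      nlinarith
    · have h1 : |b * z| ≤ |b| * M := by rw [abs_mul]; gcongr
      have h2 : |c t * l ^ 2 * y| ≤ B * l ^ 2 * M := by
        rw [abs_mul, abs_mul, abs_of_nonneg (sq_nonneg l)]; gcongr
      rw [Real.norm_eq_abs]
      have h3 : |-(b * z) - c t * l ^ 2 * y| ≤ |b * z| + |c t * l ^ 2 * y| := by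
        rw [← abs_neg (b * z)]
        exact abs_sub (-(b * z)) (c t * l ^ 2 * y)
      simp only [hK]
      nlinarith
  have hPL : IsPicardLindelof f (tmin := -1) (tmax := 2) ⟨0, by norm_num⟩ (p, q)
      ⟨K * R * 2, by positivity⟩ 0 ⟨K * R, by positivity⟩ ⟨K, hK0⟩ := by
    refine ⟨fun t ht => ?_, fun x _ => ?_, fun t ht x _ => ?_, ?_⟩
    · refine (LipschitzWith.of_dist_le_mul fun x y => ?_).lipschitzOnWith
      rw [dist_eq_norm, dist_eq_norm]
      have h1 : |x.1 - y.1| ≤ ‖x - y‖ := norm_fst_le (x - y)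
      have h2 : |x.2 - y.2| ≤ ‖x - y‖ := norm_snd_le (x - y)
      have := key t ht _ _ _ ((abs_clip_sub_le R x.1 y.1).trans h1)
        ((abs_clip_sub_le R x.2 y.2).trans h2)
      refine (le_of_eq (congrArg norm ?_)).trans this
      ext
      · simp [f]
      · simp [f]; ring
    · fun_prop
    · exact key t ht _ _ _ (abs_clip_le hR0 _) (abs_clip_le hR0 _)
    · norm_num
      rfl
  obtain ⟨x, hx0, hx⟩ := hPL.exists_eq_forall_mem_Icc_hasDerivWithinAt₀
  simp only at hx0
  have hxd : ∀ t ∈ Icc (0 : ℝ) 1, HasDerivAt x (f t (x t)) t := fun t ht =>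
    (hx t ⟨by linarith [ht.1], by linarith [ht.2]⟩).hasDerivAt
      (Icc_mem_nhds (by linarith [ht.1]) (by linarith [ht.2]))
  have hbd : ∀ t ∈ Icc (0 : ℝ) 1, ‖x t‖ ≤ R := by
    intro t ht
    have h := norm_le_gronwallBound_of_norm_deriv_right_le (f := x) (f' := fun t => f t (x t))
      (δ := ‖((p, q) : ℝ × ℝ)‖) (K := K) (ε := 0) (a := 0) (b := 1)
      (fun t ht => (hxd t ht).continuousAt.continuousWithinAt)
      (fun t ht => (hxd t ⟨ht.1, ht.2.le⟩).hasDerivWithinAt) (by rw [hx0])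
      (fun t ht => by
        rw [add_zero]
        exact key t ⟨by linarith [ht.1], by linarith [ht.2]⟩ _ _ _
          ((abs_clip_le_abs hR0 _).trans (norm_fst_le (x t)))
          ((abs_clip_le_abs hR0 _).trans (norm_snd_le (x t)))) t ht
    rw [gronwallBound_ε0] at h
    refine h.trans ?_
    rw [hR]
    gcongr
    nlinarith [ht.2, ht.1]
  have hf : ∀ t ∈ Icc (0 : ℝ) 1,
      f t (x t) = ((x t).2, -(b * (x t).2) - c t * l ^ 2 * (x t).1) := by
    intro t ht
    have h1 : |(x t).1| ≤ R := (norm_fst_le (x t)).trans (hbd t ht)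
    have h2 : |(x t).2| ≤ R := (norm_snd_le (x t)).trans (hbd t ht)
    simp only [f, clip_eq_self h1, clip_eq_self h2]
  refine ⟨fun t => (x t).1, fun t => (x t).2, by simp [hx0], by simp [hx0], fun t ht => ?_,
    fun t ht => ?_⟩
  · have := hxd t ht
    rw [hf t ht] at this
    exact this.fst
  · have := hxd t ht
    rw [hf t ht] at this
    exact this.snd

/-- A differential Grönwall inequality with constant forcing. -/
lemma le_of_deriv_le_linear {E E' : ℝ → ℝ} {k r T : ℝ} (hk : 0 ≤ k) (hr : 0 ≤ r)
    (hE : ∀ t ∈ Icc 0 T, HasDerivAt E (E' t) t)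
    (hle : ∀ t ∈ Icc 0 T, E' t ≤ k * E t + r) {t : ℝ} (ht : t ∈ Icc 0 T) :
    E t ≤ (E 0 + r * t) * Real.exp (k * t) := by
  have hanti : AntitoneOn (fun s => E s * Real.exp (-(k * s)) - r * s) (Icc 0 T) := by
    have hd : ∀ s ∈ Icc 0 T, HasDerivAt (fun s => E s * Real.exp (-(k * s)) - r * s)
        (E' s * Real.exp (-(k * s)) + E s * (Real.exp (-(k * s)) * (-(k * 1))) - r * 1) s := by
      intro s hs
      exact ((hE s hs).mul (((hasDerivAt_id s).const_mul k).neg.exp)).sub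
        ((hasDerivAt_id s).const_mul r)
    refine antitoneOn_of_deriv_nonpos (convex_Icc _ _)
      (fun s hs => (hd s hs).continuousAt.continuousWithinAt)
      (fun s hs => (hd s (interior_subset hs)).differentiableAt.differentiableWithinAt)
      (fun s hs => ?_)
    have hs' := interior_subset hs
    rw [(hd s hs').deriv]
    have h1 : Real.exp (-(k * s)) ≤ 1 := Real.exp_le_one_iff.2 (by
      have := mul_nonneg hk hs'.1; linarith)
    have h2 := Real.exp_pos (-(k * s))
    nlinarith [hle s hs', mul_le_mul_of_nonneg_right (hle s hs') h2.le]
  have h := hanti ⟨le_rfl, ht.1.trans ht.2⟩ ht ht.1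
  simp only [mul_zero, neg_zero, Real.exp_zero, mul_one, sub_zero] at h
  have h3 : E t * Real.exp (-(k * t)) ≤ E 0 + r * t := by linarith
  calc E t = E t * Real.exp (-(k * t)) * Real.exp (k * t) := by
        rw [mul_assoc, ← Real.exp_add]; simp
    _ ≤ _ := by gcongr

namespace IsModeSol

variable {c c' : ℝ → ℝ} {b l p q : ℝ} {u v u' v' : ℝ → ℝ}

lemma continuousOn_u (h : IsModeSol c b l p q u v) : ContinuousOn u (Icc 0 1) :=
  fun t ht => (h.hasDerivAt_u t ht).continuousAt.continuousWithinAt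

lemma continuousOn_v (h : IsModeSol c b l p q u v) : ContinuousOn v (Icc 0 1) :=
  fun t ht => (h.hasDerivAt_v t ht).continuousAt.continuousWithinAt

/-- Quantitative dependence of the solution on the coefficient. -/
lemma sq_sub_le (hs : IsModeSol c b l p q u v) (hs' : IsModeSol c' b l p q u' v')
    (hb : 0 ≤ b) {B M ε T : ℝ} (hT : T ≤ 1) (hB : ∀ t ∈ Icc 0 T, |c t| ≤ B)
    (hM : ∀ t ∈ Icc 0 T, |u' t| ≤ M) (hε : ∀ t ∈ Icc 0 T, |c t - c' t| ≤ ε)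
    {t : ℝ} (ht : t ∈ Icc 0 T) :
    (u t - u' t) ^ 2 ≤ (l ^ 2 * ε * M) ^ 2 * Real.exp (2 + l ^ 2 * B) := by
  have hsub : ∀ s ∈ Icc 0 T, s ∈ Icc (0 : ℝ) 1 := fun s hs => ⟨hs.1, hs.2.trans hT⟩
  have hB0 : 0 ≤ B := (abs_nonneg _).trans (hB t ht)
  have hD : ∀ s ∈ Icc 0 T, HasDerivAt (fun s => (u s - u' s) ^ 2 + (v s - v' s) ^ 2)
      (2 * (u s - u' s) * (v s - v' s) + 2 * (v s - v' s) *
        ((-(b * v s) - c s * l ^ 2 * u s) - (-(b * v' s) - c' s * l ^ 2 * u' s))) s := by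
    intro s hs1
    have h1 := ((hs.hasDerivAt_u s (hsub s hs1)).sub (hs'.hasDerivAt_u s (hsub s hs1))).pow 2
    have h2 := ((hs.hasDerivAt_v s (hsub s hs1)).sub (hs'.hasDerivAt_v s (hsub s hs1))).pow 2
    refine (h1.add h2).congr_deriv ?_
    simp
  have h := le_of_deriv_le_linear (k := 2 + l ^ 2 * B) (r := (l ^ 2 * ε * M) ^ 2) (by positivity)
    (by positivity) hD (fun s hs1 => ?_) ht
  · simp only [hs.u_zero, hs'.u_zero, hs.v_zero, hs'.v_zero, sub_self] at h
    have h3 : (u t - u' t) ^ 2 ≤ (0 ^ 2 + 0 ^ 2 + (l ^ 2 * ε * M) ^ 2 * t) *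
        Real.exp ((2 + l ^ 2 * B) * t) := by
      have := sq_nonneg (v t - v' t)
      linarith
    refine h3.trans ?_
    have ht1 := (hsub t ht).2
    have ht0 := ht.1
    gcongr
    · have : 0 ≤ (l ^ 2 * ε * M) ^ 2 := by positivity
      nlinarith
    · have : 0 ≤ 2 + l ^ 2 * B := by positivity
      nlinarith
  · have hc1 := hB s hs1
    have hc2 := hε s hs1
    have hu := hM s hs1
    have e1 : |c s - c' s| * |u' s| ≤ ε * M := by
      have := abs_nonneg (u' s)
      have := abs_nonneg (c s - c' s)
      gcongr
      linarith
    set x := u s - u' s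
    set y := v s - v' s
    have hxy : 2 * (|x| * |y|) ≤ x ^ 2 + y ^ 2 := by
      rw [← sq_abs x, ← sq_abs y]; nlinarith [sq_nonneg (|x| - |y|)]
    have e2 : -(c s * x * y) ≤ B * (|x| * |y|) := by
      refine (neg_le_abs _).trans ?_
      rw [abs_mul, abs_mul, mul_assoc]
      gcongr
    have e3 : -((c s - c' s) * u' s * y) ≤ ε * M * |y| := by
      refine (neg_le_abs _).trans ?_
      rw [abs_mul, abs_mul]
      gcongr
    have e4 : 2 * (l ^ 2 * ε * M) * |y| ≤ (l ^ 2 * ε * M) ^ 2 + y ^ 2 := by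
      rw [← sq_abs y]; nlinarith [sq_nonneg (l ^ 2 * ε * M - |y|)]
    have e5 : x * y ≤ |x| * |y| := by rw [← abs_mul]; exact le_abs_self _
    have hl2 : 0 ≤ l ^ 2 := sq_nonneg l
    have e6 := mul_le_mul_of_nonneg_left e2 hl2
    have e7 := mul_le_mul_of_nonneg_left e3 hl2
    have e8 : l ^ 2 * B * (2 * (|x| * |y|)) ≤ l ^ 2 * B * (x ^ 2 + y ^ 2) := by gcongr
    have e9 : 0 ≤ b * y ^ 2 := by positivity
    have expand : 2 * x * y + 2 * y * ((-(b * v s) - c s * l ^ 2 * u s) -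
        (-(b * v' s) - c' s * l ^ 2 * u' s)) =
        2 * (x * y) - 2 * (b * y ^ 2) + 2 * (l ^ 2 * -(c s * x * y)) +
          2 * (l ^ 2 * -((c s - c' s) * u' s * y)) := by
      simp only [x, y]; ring
    rw [expand]
    nlinarith [sq_nonneg x]

/-- Energy growth bound for low frequencies. -/
lemma energy_le_of_le (hs : IsModeSol c b l p q u v) (hb : 0 ≤ b) (hl : 0 ≤ l) {N B T : ℝ}
    (hlN : l ≤ N) (hT : T ≤ 1) (hB : ∀ t ∈ Icc 0 T, |1 - c t| ≤ B)
    {t : ℝ} (ht : t ∈ Icc 0 T) :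
    v t ^ 2 + l ^ 2 * u t ^ 2 ≤ (q ^ 2 + l ^ 2 * p ^ 2) * Real.exp (B * N * T) := by
  have hB0 : 0 ≤ B := (abs_nonneg _).trans (hB t ht)
  have hD : ∀ s ∈ Icc 0 T, HasDerivAt (fun s => v s ^ 2 + l ^ 2 * u s ^ 2)
      (2 * v s * (-(b * v s) - c s * l ^ 2 * u s) + l ^ 2 * (2 * u s * v s)) s := by
    intro s hs1
    have hs2 : s ∈ Icc (0 : ℝ) 1 := ⟨hs1.1, hs1.2.trans hT⟩
    refine (((hs.hasDerivAt_v s hs2).pow 2).add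
      (((hs.hasDerivAt_u s hs2).pow 2).const_mul (l ^ 2))).congr_deriv ?_
    simp
  have h := le_of_deriv_le_linear (k := B * N) (r := 0)
    (mul_nonneg hB0 (hl.trans hlN)) le_rfl hD (fun s hs1 => ?_) ht
  · simp only [hs.u_zero, hs.v_zero, zero_mul, add_zero] at h
    refine h.trans ?_
    have := ht.2
    have : 0 ≤ N := hl.trans hlN
    gcongr
  · have h1 := hB s hs1
    have e1 : 2 * (|v s| * |l * u s|) ≤ v s ^ 2 + l ^ 2 * u s ^ 2 := by
      rw [← mul_pow, ← sq_abs (v s), ← sq_abs (l * u s)]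
      nlinarith [sq_nonneg (|v s| - |l * u s|)]
    have e2 : (1 - c s) * (v s * (l * u s)) ≤ B * (|v s| * |l * u s|) := by
      refine (le_abs_self _).trans ?_
      rw [abs_mul, abs_mul]
      gcongr
    have e3 : l * (2 * ((1 - c s) * (v s * (l * u s)))) ≤ l * (B * (v s ^ 2 + l ^ 2 * u s ^ 2)) := by
      have : B * (2 * (|v s| * |l * u s|)) ≤ B * (v s ^ 2 + l ^ 2 * u s ^ 2) := by gcongr
      exact mul_le_mul_of_nonneg_left (by linarith) hl
    have e4 : l * (B * (v s ^ 2 + l ^ 2 * u s ^ 2)) ≤ N * (B * (v s ^ 2 + l ^ 2 * u s ^ 2)) := by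
      gcongr
    have e5 : 0 ≤ b * v s ^ 2 := by positivity
    nlinarith

end IsModeSol

/-- A continuous function with oscillation at most `w` at scale `h` has a smooth average. -/
lemma exists_average {c : ℝ → ℝ} (hc : Continuous c) {h w C₀ C₁ : ℝ} (hh : 0 < h)
    (hw : ∀ s t, |s - t| ≤ h → |c s - c t| ≤ w) (h0 : ∀ t, C₀ ≤ c t) (h1 : ∀ t, c t ≤ C₁) :
    ∃ g g' : ℝ → ℝ, (∀ t, HasDerivAt g (g' t) t) ∧ (∀ t, |g t - c t| ≤ w) ∧
      (∀ t, |g' t| ≤ w / h) ∧ (∀ t, C₀ ≤ g t) ∧ ∀ t, g t ≤ C₁ := by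
  have hint : ∀ a b, IntervalIntegrable c volume a b := fun a b => hc.intervalIntegrable a b
  have hconst : ∀ t C : ℝ, (∫ _ in t..t + h, C) = h * C := by intro t C; simp
  refine ⟨fun t => (∫ s in t..t + h, c s) / h, fun t => (c (t + h) - c t) / h,
    fun t => ?_, fun t => ?_, fun t => ?_, fun t => ?_, fun t => ?_⟩
  · have hF : ∀ t, HasDerivAt (fun t => ∫ s in (0 : ℝ)..t, c s) (c t) t := fun t =>
      intervalIntegral.integral_hasDerivAt_right (hint _ _)
        (hc.stronglyMeasurableAtFilter _ _) hc.continuousAt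
    have heq : (fun t => (∫ s in t..t + h, c s) / h) =
        fun t => ((∫ s in (0 : ℝ)..t + h, c s) - ∫ s in (0 : ℝ)..t, c s) / h := by
      funext t
      rw [intervalIntegral.integral_interval_sub_left (hint _ _) (hint _ _)]
    rw [heq]
    exact (((hF (t + h)).comp_add_const t h).sub (hF t)).div_const h
  · have : (∫ s in t..t + h, c s) / h - c t = (∫ s in t..t + h, (c s - c t)) / h := by
      rw [intervalIntegral.integral_sub (hint _ _) (by simp), hconst]
      field_simp
    simp only
    rw [this, abs_div, abs_of_pos hh, div_le_iff₀ hh]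
    have := intervalIntegral.norm_integral_le_of_norm_le_const (a := t) (b := t + h)
      (f := fun s => c s - c t) (C := w) (fun s hs => by
        rw [uIoc_of_le (by linarith)] at hs
        exact hw s t (by rw [abs_le]; constructor <;> linarith [hs.1, hs.2]))
    simpa [abs_of_pos hh] using this
  · rw [abs_div, abs_of_pos hh]
    gcongr
    exact hw _ _ (by simp [abs_of_pos hh])
  · rw [le_div_iff₀ hh, mul_comm, ← hconst t]
    exact intervalIntegral.integral_mono_on (by linarith) (by simp) (hint _ _) fun s _ => h0 s
  · rw [div_le_iff₀ hh, mul_comm C₁, ← hconst t]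
    exact intervalIntegral.integral_mono_on (by linarith) (hint _ _) (by simp) fun s _ => h1 s

namespace IsModeSol

variable {c : ℝ → ℝ} {d l p q : ℝ} {u v : ℝ → ℝ}

/-- Energy bound for high frequencies: the dissipation `2 d` absorbs the oscillations of the
coefficient at scale `1 / l`. -/
lemma energy_le_of_dissipation (hs : IsModeSol c (2 * d) l p q u v) (hc : Continuous c)
    {μ C w T : ℝ} (hμ : 0 < μ) (hl : 0 < l) (hd : 0 ≤ d) (hT : T ≤ 1)
    (hw : ∀ s t, |s - t| ≤ 1 / l → |c s - c t| ≤ w) (h0 : ∀ t, μ ≤ c t) (h1 : ∀ t, c t ≤ C)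
    (hwd : l * w ≤ d) (hwμ : l * w ≤ d * μ)
    {t : ℝ} (ht : t ∈ Icc 0 T) :
    v t ^ 2 + l ^ 2 * u t ^ 2 ≤ (2 + 1 / μ) * (2 * q ^ 2 + 3 * d ^ 2 * p ^ 2 + C * (l ^ 2 * p ^ 2)) := by
  obtain ⟨g, g', hg, hgc, hg', hg0, hg1⟩ := exists_average hc (one_div_pos.2 hl) hw h0 h1
  have hD : ∀ s ∈ Icc 0 T, HasDerivAt
      (fun s => (v s + d * u s) ^ 2 + d ^ 2 * u s ^ 2 + g s * (l ^ 2 * u s ^ 2))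
      (2 * (v s + d * u s) * ((-(2 * d * v s) - c s * l ^ 2 * u s) + d * v s) +
        d ^ 2 * (2 * u s * v s) +
        (g' s * (l ^ 2 * u s ^ 2) + g s * (l ^ 2 * (2 * u s * v s)))) s := by
    intro s hs1
    have hs2 : s ∈ Icc (0 : ℝ) 1 := ⟨hs1.1, hs1.2.trans hT⟩
    have hu := hs.hasDerivAt_u s hs2
    refine (((((hs.hasDerivAt_v s hs2).add (hu.const_mul d)).pow 2).add
      ((hu.pow 2).const_mul (d ^ 2))).add
      ((hg s).mul ((hu.pow 2).const_mul (l ^ 2)))).congr_deriv ?_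
    simp
  have h := le_of_deriv_le_linear (k := 0) (r := 0) le_rfl le_rfl hD (fun s hs1 => ?_) ht
  · simp only [hs.u_zero, hs.v_zero, zero_mul, add_zero, Real.exp_zero, mul_one] at h
    have e1 : v t ^ 2 ≤ 2 * ((v t + d * u t) ^ 2 + d ^ 2 * u t ^ 2) := by
      nlinarith [sq_nonneg (v t + 2 * d * u t)]
    have e2 : μ * (l ^ 2 * u t ^ 2) ≤ g t * (l ^ 2 * u t ^ 2) := by gcongr; exact hg0 t
    have e3 : g 0 * (l ^ 2 * p ^ 2) ≤ C * (l ^ 2 * p ^ 2) := by gcongr; exact hg1 0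
    have e4 : (q + d * p) ^ 2 ≤ 2 * q ^ 2 + 2 * d ^ 2 * p ^ 2 := by
      nlinarith [sq_nonneg (q - d * p)]
    have e5 : 0 ≤ g t * (l ^ 2 * u t ^ 2) :=
      mul_nonneg (hμ.le.trans (hg0 t)) (by positivity)
    set E := (v t + d * u t) ^ 2 + d ^ 2 * u t ^ 2 + g t * (l ^ 2 * u t ^ 2) with hE
    have e6 : l ^ 2 * u t ^ 2 ≤ 1 / μ * E := by
      rw [one_div, inv_mul_eq_div, le_div_iff₀ hμ]
      nlinarith [sq_nonneg (v t + d * u t), sq_nonneg (d * u t)]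
    calc v t ^ 2 + l ^ 2 * u t ^ 2 ≤ (2 + 1 / μ) * E := by
          rw [add_mul]; linarith
      _ ≤ _ := by gcongr; linarith
  · have a1 := hgc s
    have a2 := hg' s
    rw [div_div_eq_mul_div, div_one] at a2
    set y := l * u s with hy
    have e1 : (g s - c s) * (y * v s) ≤ w * (|y| * |v s|) := by
      refine (le_abs_self _).trans ?_
      rw [abs_mul, abs_mul]
      gcongr
    have e2 : 2 * (|y| * |v s|) ≤ y ^ 2 + v s ^ 2 := by
      rw [← sq_abs y, ← sq_abs (v s)]; nlinarith [sq_nonneg (|y| - |v s|)]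
    have hw0 : 0 ≤ w := (abs_nonneg _).trans a1
    have e3 : l * w * (2 * (|y| * |v s|)) ≤ l * w * (y ^ 2 + v s ^ 2) := by gcongr
    have e3' := mul_le_mul_of_nonneg_left e1 hl.le
    have e4 : g' s * y ^ 2 ≤ w * l * y ^ 2 := by
      gcongr
      exact (le_abs_self _).trans a2
    have e5 : l * w * y ^ 2 ≤ d * μ * y ^ 2 := by gcongr
    have e6 : l * w * v s ^ 2 ≤ d * v s ^ 2 := by gcongr
    have e7 : d * μ * y ^ 2 ≤ d * c s * y ^ 2 := by gcongr; exact h0 s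
    have e8 : 0 ≤ d * v s ^ 2 := by positivity
    have expand : 2 * (v s + d * u s) * ((-(2 * d * v s) - c s * l ^ 2 * u s) + d * v s) +
        d ^ 2 * (2 * u s * v s) + (g' s * (l ^ 2 * u s ^ 2) + g s * (l ^ 2 * (2 * u s * v s))) =
        -(2 * (d * v s ^ 2)) - 2 * (d * c s * y ^ 2) + g' s * y ^ 2 +
          2 * (l * ((g s - c s) * (y * v s))) := by
      simp only [hy]; ring
    rw [expand]
    nlinarith

end IsModeSol

namespace IsModulus

variable {ω ωd ωm : ℝ → ℝ}

lemma zero (h : IsModulus ω) : ω 0 = 0 := h.2.1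

lemma pos (h : IsModulus ω) {x : ℝ} (hx : 0 < x) : 0 < ω x := h.2.2.1 x hx

lemma mono (h : IsModulus ω) {x y : ℝ} (hx : 0 ≤ x) (hxy : x ≤ y) : ω x ≤ ω y :=
  h.2.2.2.1 x y hx hxy

lemma nonneg (h : IsModulus ω) {x : ℝ} (hx : 0 ≤ x) : 0 ≤ ω x := h.zero ▸ h.mono le_rfl hx

lemma continuous_comp_abs (h : IsModulus ω) {f : ℝ → ℝ} (hf : Continuous f) :
    Continuous fun x => ω |f x| :=
  h.1.comp_continuous hf.abs fun x => abs_nonneg (f x)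

lemma continuous_comp_comp_abs (hm : IsModulus ωm) (hd : IsModulus ωd) {A : ℝ} (hA : 0 ≤ A)
    {f : ℝ → ℝ} (hf : Continuous f) : Continuous fun x => ωm (A * ωd |f x|) :=
  hm.1.comp_continuous (continuous_const.mul (hd.continuous_comp_abs hf))
    fun _ => mul_nonneg hA (hd.nonneg (abs_nonneg _))

lemma tendsto_zero (h : IsModulus ω) : Tendsto ω (𝓝[>] 0) (𝓝 0) := by
  have := (h.1 0 (mem_Ici.2 le_rfl)).mono_left (nhdsWithin_mono 0 Ioi_subset_Ici_self)
  rwa [h.zero] at this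

lemma tendsto_comp_zero (hm : IsModulus ωm) (hd : IsModulus ωd) {A : ℝ} (hA : 0 < A) :
    Tendsto (fun x => A * ωd x) (𝓝[>] 0) (𝓝[>] 0) ∧
      Tendsto (fun x => ωm (A * ωd x)) (𝓝[>] 0) (𝓝 0) := by
  have h1 : Tendsto (fun x => A * ωd x) (𝓝[>] 0) (𝓝[>] 0) := by
    refine tendsto_nhdsWithin_iff.2 ⟨?_, ?_⟩
    · simpa using hd.tendsto_zero.const_mul A
    · filter_upwards [self_mem_nhdsWithin] with x hx
      exact mul_pos hA (hd.pos hx)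
  exact ⟨h1, hm.tendsto_zero.comp h1⟩

lemma continuous_of_abs_sub_le (hm : IsModulus ωm) (hd : IsModulus ωd) {A : ℝ} (hA : 0 ≤ A)
    {f : ℝ → ℝ} (hf : ∀ s t, |f s - f t| ≤ ωm (A * ωd |s - t|)) : Continuous f := by
  refine continuous_iff_continuousAt.2 fun t => ?_
  refine tendsto_iff_dist_tendsto_zero.2 (squeeze_zero (fun _ => dist_nonneg)
    (fun s => (hf s t)) ?_)
  have := (hm.continuous_comp_comp_abs hd hA (f := fun s => s - t) (by fun_prop)).tendsto t
  simpa [hd.zero, hm.zero] using this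

/-- The compatibility condition between `ωm`, `ωd`, `α` and `σ`, in the form of smallness of the
oscillation of `m` at time scale `h`. -/
lemma eventually_comp_le (hm : IsModulus ωm) (hd : IsModulus ωd) {σ α : ℝ} (hσ : σ ≤ 1 / 2)
    (hα : 0 ≤ α)
    (hlimsup : ∃ C : ℝ, ∀ᶠ x in 𝓝[>] (0:ℝ), ωm x ^ (4 * α) / x ^ (1 - 2 * σ) ≤ C)
    (hlim : Tendsto (fun x => ωd x / x ^ (4 * α)) (𝓝[>] (0:ℝ)) (𝓝 0))
    {A κ : ℝ} (hA : 0 < A) (hκ : 0 < κ) :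
    ∀ᶠ h in 𝓝[>] (0:ℝ), ωm (A * ωd h) ≤ κ * h ^ (1 - 2 * σ) := by
  obtain ⟨hy, hmy⟩ := hm.tendsto_comp_zero hd hA
  rcases hσ.eq_or_lt with rfl | hσ
  · filter_upwards [hmy.eventually (gt_mem_nhds hκ)] with h hh
    norm_num
    exact hh.le
  have hβ : 0 < 1 - 2 * σ := by linarith
  obtain ⟨C, hC⟩ := hlimsup
  have hα' : 0 < 4 * α := by
    rcases hα.eq_or_lt with rfl | h
    · exfalso
      have h1 : Tendsto (fun x : ℝ => x ^ (1 - 2 * σ)) (𝓝[>] 0) (𝓝[>] 0) := by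
        refine tendsto_nhdsWithin_iff.2 ⟨?_, ?_⟩
        · have := (Real.continuousAt_rpow_const 0 (1 - 2 * σ) (Or.inr hβ.le)).tendsto
          rw [Real.zero_rpow hβ.ne'] at this
          exact this.mono_left nhdsWithin_le_nhds
        · filter_upwards [self_mem_nhdsWithin] with x hx
          exact Real.rpow_pos_of_pos hx _
      have h2 := (tendsto_inv_nhdsGT_zero.comp h1).eventually (eventually_gt_atTop C)
      obtain ⟨x, hx1, hx2⟩ := (hC.and h2).exists
      simp at hx1 hx2
      linarith
    · linarith
  set D := max C 1 with hDdef
  have hD : 0 < D := lt_max_of_lt_right one_pos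
  have hsmall : Tendsto (fun h => D * (A * (ωd h / h ^ (4 * α))) ^ (1 - 2 * σ)) (𝓝[>] 0) (𝓝 0) := by
    have h1 := ((hlim.const_mul A).rpow_const (p := 1 - 2 * σ) (Or.inr hβ.le)).const_mul D
    simpa [Real.zero_rpow hβ.ne'] using h1
  filter_upwards [hy.eventually hC, hsmall.eventually (gt_mem_nhds (Real.rpow_pos_of_pos hκ (4 * α))),
    self_mem_nhdsWithin] with h h1 h2 (h0 : 0 < h)
  have hdh := hd.pos h0
  have hyp : 0 < A * ωd h := mul_pos hA hdh
  have hh : 0 < h ^ (4 * α) := Real.rpow_pos_of_pos h0 _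
  have h3 : ωm (A * ωd h) ^ (4 * α) ≤ D * (A * ωd h) ^ (1 - 2 * σ) := by
    rw [div_le_iff₀ (Real.rpow_pos_of_pos hyp _)] at h1
    refine h1.trans ?_
    gcongr
    exact le_max_left _ _
  have h4 : A * ωd h = A * (ωd h / h ^ (4 * α)) * h ^ (4 * α) := by field_simp
  have h5 : (A * ωd h) ^ (1 - 2 * σ) =
      (A * (ωd h / h ^ (4 * α))) ^ (1 - 2 * σ) * (h ^ (1 - 2 * σ)) ^ (4 * α) := by
    rw [h4, Real.mul_rpow (by positivity) hh.le, ← Real.rpow_mul h0.le,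
      ← Real.rpow_mul h0.le, mul_comm (4 * α)]
  refine (Real.rpow_le_rpow_iff (hm.nonneg hyp.le) (by positivity) hα').1 ?_
  rw [Real.mul_rpow hκ.le (by positivity)]
  refine h3.trans ?_
  rw [h5, ← mul_assoc]
  gcongr

/-- The compatibility condition in terms of frequencies. -/
lemma exists_frequency_threshold (hm : IsModulus ωm) (hd : IsModulus ωd) {σ α : ℝ}
    (hσ : σ ≤ 1 / 2) (hα : 0 ≤ α)
    (hlimsup : ∃ C : ℝ, ∀ᶠ x in 𝓝[>] (0:ℝ), ωm x ^ (4 * α) / x ^ (1 - 2 * σ) ≤ C)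
    (hlim : Tendsto (fun x => ωd x / x ^ (4 * α)) (𝓝[>] (0:ℝ)) (𝓝 0))
    {A κ : ℝ} (hA : 0 < A) (hκ : 0 < κ) :
    ∃ N : ℝ, 1 ≤ N ∧ ∀ l, N ≤ l → l * ωm (A * ωd (1 / l)) ≤ κ * l ^ (2 * σ) := by
  have h := (tendsto_inv_atTop_nhdsGT_zero (𝕜 := ℝ)).eventually
    (hm.eventually_comp_le hd hσ hα hlimsup hlim hA hκ)
  obtain ⟨N, hN⟩ := (h.and (eventually_ge_atTop 1)).exists_forall_of_atTop
  refine ⟨N, (hN N le_rfl).2, fun l hl => ?_⟩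
  obtain ⟨h1, h2⟩ := hN l hl
  have hl0 : 0 < l := by linarith
  rw [one_div]
  calc l * ωm (A * ωd l⁻¹) ≤ l * (κ * l⁻¹ ^ (1 - 2 * σ)) := by gcongr
    _ = κ * l ^ (2 * σ) := by
      rw [Real.inv_rpow hl0.le, Real.rpow_sub hl0, Real.rpow_one]
      have := (Real.rpow_pos_of_pos hl0 (2 * σ)).ne'
      field_simp

/-- Interpolation between the size and the time derivative of a single mode. -/
lemma abs_mode_sub_le (hd : IsModulus ωd) {l W T : ℝ} (hl : 0 < l) {u v : ℝ → ℝ}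
    (hu : ∀ t ∈ Icc 0 T, HasDerivAt u (v t) t)
    (hW : ∀ t ∈ Icc 0 T, v t ^ 2 + l ^ 2 * u t ^ 2 ≤ W * ωd (1 / l))
    {s t : ℝ} (hs : s ∈ Icc 0 T) (ht : t ∈ Icc 0 T) :
    |l ^ 2 * u s ^ 2 - l ^ 2 * u t ^ 2| ≤ W * ωd |s - t| := by
  have hl' : 0 < 1 / l := one_div_pos.2 hl
  have hdl := hd.pos hl'
  have hW0 : 0 ≤ W := by
    have h1 := hW s hs
    have h2 : 0 ≤ v s ^ 2 + l ^ 2 * u s ^ 2 := by positivity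
    exact nonneg_of_mul_nonneg_left (h2.trans h1) hdl
  rcases (abs_nonneg (s - t)).eq_or_lt with h0 | h0
  · have : s = t := by rw [eq_comm, abs_eq_zero, sub_eq_zero] at h0; exact h0
    simp [this, hd.zero]
  rcases le_total (1 / l) |s - t| with h | h
  · have e1 := hW s hs
    have e2 := hW t ht
    have e3 : W * ωd (1 / l) ≤ W * ωd |s - t| := by gcongr; exact hd.mono hl'.le h
    have e4 : 0 ≤ l ^ 2 * u s ^ 2 := by positivity
    have e5 : 0 ≤ l ^ 2 * u t ^ 2 := by positivity
    rw [abs_le]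
    constructor <;> nlinarith [sq_nonneg (v s), sq_nonneg (v t)]
  · have hmv := Convex.norm_image_sub_le_of_norm_hasDerivWithin_le (s := Icc 0 T)
      (f := fun t => l ^ 2 * u t ^ 2) (f' := fun t => l ^ 2 * (2 * u t * v t))
      (C := l * (W * ωd (1 / l))) (fun t ht => by
        refine ((((hu t ht).pow 2).const_mul (l ^ 2)).congr_deriv ?_).hasDerivWithinAt
        simp) (fun t ht => by
        have h1 : |l ^ 2 * (2 * u t * v t)| = l * (2 * (|l * u t| * |v t|)) := by
          rw [abs_mul, abs_mul, abs_mul, abs_mul, abs_of_pos hl, abs_of_pos (pow_pos hl 2)]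
          norm_num
          ring
        rw [Real.norm_eq_abs, h1]
        have h2 : 2 * (|l * u t| * |v t|) ≤ v t ^ 2 + l ^ 2 * u t ^ 2 := by
          rw [← mul_pow, ← sq_abs (v t), ← sq_abs (l * u t)]
          nlinarith [sq_nonneg (|v t| - |l * u t|)]
        exact mul_le_mul_of_nonneg_left (h2.trans (hW t ht)) hl.le) (convex_Icc _ _) ht hs
    simp only [Real.norm_eq_abs] at hmv
    refine hmv.trans ?_
    have h3 := hd.2.2.2.2 _ _ h0 h
    rw [div_le_div_iff₀ (hd.pos h0) hdl] at h3
    have h4 : l * ωd (1 / l) * |s - t| ≤ ωd |s - t| := by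
      calc l * ωd (1 / l) * |s - t| = l * (|s - t| * ωd (1 / l)) := by ring
        _ ≤ l * (1 / l * ωd |s - t|) := by gcongr
        _ = ωd |s - t| := by field_simp
    calc l * (W * ωd (1 / l)) * |s - t| = W * (l * ωd (1 / l) * |s - t|) := by ring
      _ ≤ _ := by gcongr

end IsModulus

/-- The squared norm `|A^{1/2} u(t)|²`. -/
def gradEnergy (lam : ℕ → ℝ) (u : ℕ → ℝ → ℝ) (t : ℝ) : ℝ := ∑' j, lam j ^ 2 * u j t ^ 2

/-- If every mode has its energy controlled by the initial one, then `|A^{1/2} u|²` has `ωd` as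
a modulus of continuity in time. -/
lemma abs_gradEnergy_sub_le {lam : ℕ → ℝ} (hlam : ∀ k, 0 ≤ lam k) {ωd : ℝ → ℝ}
    (hd : IsModulus ωd) {u0 u1 : ℕ → ℝ} (hV : MemV lam ωd u0 u1) {K T : ℝ}
    {u v : ℕ → ℝ → ℝ} (hu : ∀ k, ∀ t ∈ Icc 0 T, HasDerivAt (u k) (v k t) t)
    (hK : ∀ k, ∀ t ∈ Icc 0 T,
      v k t ^ 2 + lam k ^ 2 * u k t ^ 2 ≤ K * (u1 k ^ 2 + lam k ^ 2 * u0 k ^ 2))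
    {s t : ℝ} (hs : s ∈ Icc 0 T) (ht : t ∈ Icc 0 T) :
    |gradEnergy lam u s - gradEnergy lam u t| ≤
      K * (∑' k, Vsum lam ωd u0 u1 k) * ωd |s - t| := by
  have hsum : ∀ r ∈ Icc 0 T, Summable fun k => lam k ^ 2 * u k r ^ 2 := by
    intro r hr
    refine Summable.of_nonneg_of_le (fun k => by positivity) (fun k => ?_)
      ((hV.2.2.1.add hV.2.1).mul_left K)
    exact (le_add_of_nonneg_left (sq_nonneg _)).trans (hK k r hr)
  unfold gradEnergy
  rw [← (hsum s hs).tsum_sub (hsum t ht), ← Real.norm_eq_abs, mul_assoc, mul_comm _ (ωd _),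
    ← mul_assoc, ← tsum_mul_left]
  refine tsum_of_norm_bounded (hV.2.2.2.mul_left _).hasSum fun k => ?_
  rw [Real.norm_eq_abs]
  rcases (hlam k).eq_or_lt with h0 | h0
  · simp [← h0, Vsum]
  · have hdk := hd.pos (one_div_pos.2 h0)
    have := hd.abs_mode_sub_le (W := K * Vsum lam ωd u0 u1 k) h0 (hu k) (fun r hr => by
      refine (hK k r hr).trans (le_of_eq ?_)
      rw [Vsum, if_pos h0]
      field_simp) hs ht
    linarith

/-- Dominated componentwise continuity implies continuity in `ℓ²`. -/
lemma l2Cont_of_dominated {I : Set ℝ} {v : ℝ → ℕ → ℝ} {a : ℕ → ℝ} (ha : Summable a)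
    (hb : ∀ t ∈ I, ∀ k, v t k ^ 2 ≤ a k) (hc : ∀ k, ContinuousOn (fun t => v t k) I) :
    L2Cont I v := by
  refine ⟨fun t ht => Summable.of_nonneg_of_le (fun k => sq_nonneg _) (hb t ht) ha,
    fun t ht ε hε => ?_⟩
  have h : Tendsto (fun s => ∑' k, (v s k - v t k) ^ 2) (𝓝[I] t) (𝓝 (∑' _ : ℕ, (0 : ℝ))) := by
    refine tendsto_tsum_of_dominated_convergence (ha.mul_left 4) (fun k => ?_) ?_
    · have := ((hc k t ht).sub_const (v t k)).pow 2
      simpa using this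
    · filter_upwards [self_mem_nhdsWithin] with s hs k
      rw [Real.norm_eq_abs, abs_of_nonneg (sq_nonneg _)]
      nlinarith [hb s hs k, hb t ht k, sq_nonneg (v s k + v t k)]
  rw [tsum_zero] at h
  obtain ⟨η, hη, hsub⟩ := Metric.mem_nhdsWithin_iff.1 (h.eventually (gt_mem_nhds hε))
  exact ⟨η, hη, fun s hs hst => hsub ⟨hst, hs⟩⟩

/-- Candidates for `t ↦ |A^{1/2} u(t)|²`, with a prescribed modulus of continuity. -/
structure IsCandidate (ωd : ℝ → ℝ) (A T F₀ : ℝ) (F : ℝ → ℝ) : Prop where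
  nonneg : ∀ t, 0 ≤ F t
  abs_sub_le : ∀ s t, |F s - F t| ≤ A * ωd |s - t|
  abs_sub_init_le : ∀ t, |F t - F₀| ≤ A * ωd T

namespace IsCandidate

variable {ωd ωm m F : ℝ → ℝ} {A T F₀ : ℝ}

lemma abs_comp_sub_le (hF : IsCandidate ωd A T F₀ F) (hm : IsModulus ωm)
    (hmc : ∀ a b : ℝ, 0 ≤ a → 0 ≤ b → |m a - m b| ≤ ωm |a - b|) (s t : ℝ) :
    |m (F s) - m (F t)| ≤ ωm (A * ωd |s - t|) :=
  (hmc _ _ (hF.nonneg s) (hF.nonneg t)).trans (hm.mono (abs_nonneg _) (hF.abs_sub_le s t))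

lemma continuous_comp (hF : IsCandidate ωd A T F₀ F) (hm : IsModulus ωm) (hd : IsModulus ωd)
    (hA : 0 ≤ A) (hmc : ∀ a b : ℝ, 0 ≤ a → 0 ≤ b → |m a - m b| ≤ ωm |a - b|) :
    Continuous fun t => m (F t) :=
  hm.continuous_of_abs_sub_le hd hA (hF.abs_comp_sub_le hm hmc)

lemma abs_comp_sub_init_le (hF : IsCandidate ωd A T F₀ F) (hF₀ : 0 ≤ F₀) (hm : IsModulus ωm)
    (hmc : ∀ a b : ℝ, 0 ≤ a → 0 ≤ b → |m a - m b| ≤ ωm |a - b|) (t : ℝ) :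
    |m (F t) - m F₀| ≤ ωm (A * ωd T) :=
  (hmc _ _ (hF.nonneg t) hF₀).trans (hm.mono (abs_nonneg _) (hF.abs_sub_init_le t))

end IsCandidate

/-- Uniform energy control of all modes, on a time interval depending only on the modulus of
continuity of the candidate `F`. -/
lemma exists_energy_control
    {lam : ℕ → ℝ} (hlam : ∀ k, 0 ≤ lam k) {μ₁ : ℝ} (hμ₁ : 0 < μ₁)
    {m : ℝ → ℝ} (hmlb : ∀ x : ℝ, 0 ≤ x → μ₁ ≤ m x) {ωm ωd : ℝ → ℝ} (hωm : IsModulus ωm)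
    (hmc : ∀ a b : ℝ, 0 ≤ a → 0 ≤ b → |m a - m b| ≤ ωm |a - b|)
    {σ δ α : ℝ} (hσ : σ ≤ 1 / 2) (hδ : 0 < δ) (hα0 : 0 ≤ α)
    (hlimsup : ∃ C : ℝ, ∀ᶠ x in 𝓝[>] (0:ℝ), ωm x ^ (4 * α) / x ^ (1 - 2 * σ) ≤ C)
    (hωd : IsModulus ωd) (hωdlim : Tendsto (fun x => ωd x / x ^ (4 * α)) (𝓝[>] (0:ℝ)) (𝓝 0))
    {F₀ : ℝ} (hF₀ : 0 ≤ F₀) :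
    ∃ K : ℝ, 0 ≤ K ∧ ∀ A : ℝ, 0 < A → ∃ T : ℝ, 0 < T ∧ T ≤ 1 ∧
      ∀ F, IsCandidate ωd A T F₀ F → ∀ k p q u v,
        IsModeSol (fun t => m (F t)) (2 * δ * lam k ^ (2 * σ)) (lam k) p q u v →
        ∀ t ∈ Icc 0 T, v t ^ 2 + lam k ^ 2 * u t ^ 2 ≤ K * (q ^ 2 + lam k ^ 2 * p ^ 2) := by
  set C := m F₀ + 1 with hC
  have hm0 := hmlb F₀ hF₀
  have hCpos : 0 < C := by linarith
  refine ⟨(2 + 1 / μ₁) * (2 + 3 * δ ^ 2 + C), by positivity, fun A hA => ?_⟩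
  have hκ : 0 < δ * min 1 μ₁ := mul_pos hδ (lt_min one_pos hμ₁)
  obtain ⟨N, hN1, hN⟩ := hωm.exists_frequency_threshold hωd hσ hα0 hlimsup hωdlim hA hκ
  have hBN : 0 < (C + 1) * N := by positivity
  have hsmall := (hωm.tendsto_comp_zero hωd hA).2.eventually (gt_mem_nhds one_pos)
  have hT' : ∀ᶠ T : ℝ in 𝓝[>] 0, T < min 1 (1 / ((C + 1) * N)) :=
    mem_nhdsWithin_of_mem_nhds (gt_mem_nhds (lt_min one_pos (one_div_pos.2 hBN)))
  obtain ⟨T, ⟨hT1, hT2⟩, hT0 : 0 < T⟩ :=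
    ((hsmall.and hT').and self_mem_nhdsWithin).exists
  have hT3 : T ≤ 1 := hT2.le.trans (min_le_left _ _)
  have hT4 : (C + 1) * N * T ≤ 1 := by
    have := hT2.le.trans (min_le_right _ _)
    rwa [le_div_iff₀ hBN, mul_comm] at this
  refine ⟨T, hT0, hT3, fun F hF k p q u v hs t ht => ?_⟩
  have hcle : ∀ t, m (F t) ≤ C := fun t => by
    have := (hF.abs_comp_sub_init_le hF₀ hωm hmc t).trans hT1.le
    rw [abs_le] at this
    linarith
  have hcge : ∀ t, μ₁ ≤ m (F t) := fun t => hmlb _ (hF.nonneg t)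
  have hlk := hlam k
  have hdiv : 0 < 1 / μ₁ := one_div_pos.2 hμ₁
  have hδ2 : 0 < δ ^ 2 := by positivity
  have he : 0 ≤ q ^ 2 + lam k ^ 2 * p ^ 2 := by positivity
  rcases le_total (lam k) N with hle | hge
  · have h := hs.energy_le_of_le (by positivity) hlk hle hT3 (B := C + 1) (fun t _ => by
      rw [abs_le]; constructor <;> linarith [hcle t, hcge t]) ht
    refine h.trans ?_
    rw [mul_comm]
    gcongr
    have h1 : Real.exp ((C + 1) * N * T) ≤ Real.exp 1 := Real.exp_le_exp.2 hT4
    have h2 := Real.exp_one_lt_d9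
    nlinarith [mul_pos hdiv hδ2, mul_pos hdiv hCpos]
  · have hl1 : 1 ≤ lam k := hN1.trans hge
    have hl0 : 0 < lam k := by linarith
    have hw := hN _ hge
    have hpow : 0 ≤ lam k ^ (2 * σ) := by positivity
    rw [mul_assoc] at hs
    have h := hs.energy_le_of_dissipation (hF.continuous_comp hωm hωd hA.le hmc) hμ₁ hl0
      (d := δ * lam k ^ (2 * σ)) (by positivity) hT3
      (w := ωm (A * ωd (1 / lam k))) (fun s t hst => ?_) hcge hcle ?_ ?_ ht
    · refine h.trans ?_
      rw [mul_assoc (2 + 1 / μ₁)]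
      gcongr
      have h1 : lam k ^ (2 * σ) ≤ lam k := by
        calc lam k ^ (2 * σ) ≤ lam k ^ (1 : ℝ) := by gcongr; linarith
          _ = lam k := Real.rpow_one _
      have h2 : (δ * lam k ^ (2 * σ)) ^ 2 ≤ δ ^ 2 * lam k ^ 2 := by
        rw [mul_pow]; gcongr
      have h3 : (δ * lam k ^ (2 * σ)) ^ 2 * p ^ 2 ≤ δ ^ 2 * lam k ^ 2 * p ^ 2 := by gcongr
      have h4 : 0 ≤ (3 * δ ^ 2 + C) * q ^ 2 := by positivity
      have h5 : 0 ≤ lam k ^ 2 * p ^ 2 := by positivity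
      linarith
    · refine (hF.abs_comp_sub_le hωm hmc s t).trans (hωm.mono ?_ ?_)
      · exact mul_nonneg hA.le (hωd.nonneg (abs_nonneg _))
      · have := hωd.mono (abs_nonneg _) hst
        gcongr
    · refine hw.trans ?_
      have : min 1 μ₁ ≤ 1 := min_le_left _ _
      gcongr
      exact mul_le_of_le_one_right hδ.le this
    · refine hw.trans ?_
      have : min 1 μ₁ ≤ μ₁ := min_le_right _ _
      calc δ * min 1 μ₁ * lam k ^ (2 * σ) ≤ δ * μ₁ * lam k ^ (2 * σ) := by gcongr
        _ = _ := by ring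

/-- Candidates converging pointwise along a filter converge uniformly on `[0, T]`. -/
lemma IsCandidate.eventually_dist_lt {ι : Type*} {l : Filter ι} {ωd : ℝ → ℝ} (hd : IsModulus ωd)
    {A T F₀ : ℝ} {F : ι → ℝ → ℝ} {G : ℝ → ℝ} (hF : ∀ n, IsCandidate ωd A T F₀ (F n))
    (hlim : ∀ t, Tendsto (fun n => F n t) l (𝓝 (G t))) {ε : ℝ} (hε : 0 < ε) :
    ∀ᶠ n in l, ∀ t ∈ Icc 0 T, |F n t - G t| < ε := by
  have hequi : Equicontinuous fun n (t : Icc 0 T) => F n t := by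
    refine Metric.equicontinuous_of_continuity_modulus (fun x => A * ωd |x|) ?_ _ ?_
    · have hcont : Continuous fun x : ℝ => A * ωd |x| :=
        continuous_const.mul (hd.continuous_comp_abs continuous_id)
      simpa [hd.zero] using hcont.tendsto 0
    · intro x y n
      rw [Subtype.dist_eq, Real.dist_eq, Real.dist_eq, abs_abs]
      exact (hF n).abs_sub_le x y
  have h := (hequi.tendsto_uniformFun_iff_pi l fun t : Icc 0 T => G t).2
    (tendsto_pi_nhds.2 fun t => hlim t)
  have h2 := Metric.tendstoUniformly_iff.1 (UniformFun.tendsto_iff_tendstoUniformly.1 h) ε hε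
  filter_upwards [h2] with n hn t ht
  have := hn ⟨t, ht⟩
  rw [dist_comm] at this
  exact this

/-- Existence of a self-consistent coefficient, given uniform energy control of all modes. The
equation with delay is solved by iteration, and the delay is then sent to `0`. -/
lemma exists_selfConsistent
    {lam b : ℕ → ℝ} (hlam : ∀ k, 0 ≤ lam k) (hb : ∀ k, 0 ≤ b k)
    {m ωm ωd : ℝ → ℝ} (hωm : IsModulus ωm)
    (hmc : ∀ a b : ℝ, 0 ≤ a → 0 ≤ b → |m a - m b| ≤ ωm |a - b|) (hωd : IsModulus ωd)
    {u0 u1 : ℕ → ℝ} (hV : MemV lam ωd u0 u1) {K A T : ℝ} (hA : 0 < A)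
    (hKA : K * (∑' k, Vsum lam ωd u0 u1 k) ≤ A) (hT0 : 0 < T) (hT1 : T ≤ 1)
    (hctrl : ∀ F, IsCandidate ωd A T (∑' k, lam k ^ 2 * u0 k ^ 2) F → ∀ k p q u v,
        IsModeSol (fun t => m (F t)) (b k) (lam k) p q u v →
        ∀ t ∈ Icc 0 T, v t ^ 2 + lam k ^ 2 * u t ^ 2 ≤ K * (q ^ 2 + lam k ^ 2 * p ^ 2)) :
    ∃ F, IsCandidate ωd A T (∑' k, lam k ^ 2 * u0 k ^ 2) F ∧ ∃ u v : ℕ → ℝ → ℝ,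
      (∀ k, IsModeSol (fun t => m (F t)) (b k) (lam k) (u0 k) (u1 k) (u k) (v k)) ∧
      ∀ t ∈ Icc 0 T, F t = gradEnergy lam u t := by
  set F₀ := ∑' k, lam k ^ 2 * u0 k ^ 2 with hF₀def
  have hF₀ : 0 ≤ F₀ := tsum_nonneg fun k => by positivity
  have hsub : Icc 0 T ⊆ Icc (0 : ℝ) 1 := Icc_subset_Icc_right hT1
  have hex : ∀ F : ℝ → ℝ, ∃ u v : ℕ → ℝ → ℝ, IsCandidate ωd A T F₀ F →
      ∀ k, IsModeSol (fun t => m (F t)) (b k) (lam k) (u0 k) (u1 k) (u k) (v k) := by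
    intro F
    by_cases hF : IsCandidate ωd A T F₀ F
    · choose u v h using fun k => exists_isModeSol (hF.continuous_comp hωm hωd hA.le hmc)
        (b k) (lam k) (u0 k) (u1 k)
      exact ⟨u, v, fun _ => h⟩
    · exact ⟨0, 0, fun h => absurd h hF⟩
  choose U V hUV using hex
  set G : (ℝ → ℝ) → ℝ → ℝ := fun F => gradEnergy lam (U F) with hG
  have hGmod : ∀ F, IsCandidate ωd A T F₀ F → ∀ s ∈ Icc 0 T, ∀ t ∈ Icc 0 T,
      |G F s - G F t| ≤ A * ωd |s - t| := by
    intro F hF s hs t ht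
    refine (abs_gradEnergy_sub_le hlam hωd hV
      (fun k r hr => (hUV F hF k).hasDerivAt_u r (hsub hr))
      (fun k r hr => hctrl F hF k _ _ _ _ (hUV F hF k) r hr) hs ht).trans ?_
    have := hωd.nonneg (abs_nonneg (s - t))
    gcongr
  have hG0 : ∀ F, IsCandidate ωd A T F₀ F → G F 0 = F₀ := by
    intro F hF
    simp only [hG, gradEnergy, hF₀def, (hUV F hF _).u_zero]
  -- continuous dependence of a single mode on the candidate
  have hdep : ∀ F, IsCandidate ωd A T F₀ F → ∀ k, ∃ D : ℝ, 0 ≤ D ∧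
      ∀ F', IsCandidate ωd A T F₀ F' → ∀ s ≤ T, ∀ ε, (∀ t ∈ Icc 0 s, |F' t - F t| ≤ ε) →
      ∀ t ∈ Icc 0 s, (U F' k t - U F k t) ^ 2 ≤ D * ωm ε ^ 2 := by
    intro F hF k
    obtain ⟨M, hM⟩ := isCompact_Icc.exists_bound_of_continuousOn (hUV F hF k).continuousOn_u
    refine ⟨(lam k ^ 2 * M) ^ 2 * Real.exp (2 + lam k ^ 2 * (|m F₀| + ωm (A * ωd T))),
      by positivity, fun F' hF' s hs ε hε t ht => ?_⟩
    refine ((hUV F' hF' k).sq_sub_le (hUV F hF k) (hb k) (hs.trans hT1)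
      (B := |m F₀| + ωm (A * ωd T)) (M := M) (ε := ωm ε) (fun r _ => ?_)
      (fun r hr => hM r ⟨hr.1, hr.2.trans (hs.trans hT1)⟩) (fun r hr => ?_) ht).trans
      (le_of_eq (by ring))
    · have h1 := hF'.abs_comp_sub_init_le hF₀ hωm hmc r
      have h2 := abs_sub_abs_le_abs_sub (m (F' r)) (m F₀)
      linarith
    · exact (hmc _ _ (hF'.nonneg r) (hF.nonneg r)).trans (hωm.mono (abs_nonneg _) (hε r hr))
  have hcausal : ∀ F F', IsCandidate ωd A T F₀ F → IsCandidate ωd A T F₀ F' → ∀ s ≤ T,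
      (∀ t ∈ Icc 0 s, F' t = F t) → ∀ t ∈ Icc 0 s, G F' t = G F t := by
    intro F F' hF hF' s hs heq t ht
    refine tsum_congr fun k => ?_
    obtain ⟨D, -, h⟩ := hdep F hF k
    have h1 := h F' hF' s hs 0 (fun r hr => by simp [heq r hr]) t ht
    rw [hωm.zero] at h1
    have h2 : U F' k t - U F k t = 0 := by
      apply pow_eq_zero_iff (two_ne_zero) |>.1
      exact le_antisymm (by simpa using h1) (sq_nonneg _)
    rw [sub_eq_zero.1 h2]
  -- the delayed iteration
  have hclamp : ∀ x : ℝ, max 0 (min x T) ∈ Icc 0 T := fun x =>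
    ⟨le_max_left _ _, max_le hT0.le (min_le_right _ _)⟩
  have hclampsub : ∀ x y : ℝ, |max 0 (min x T) - max 0 (min y T)| ≤ |x - y| := fun x y => by
    have h := abs_min_sub_min_le_max x T y T
    have h2 := abs_max_sub_max_le_max 0 (min x T) 0 (min y T)
    simp only [sub_self, abs_zero, abs_nonneg, sup_of_le_right, sup_of_le_left] at h h2
    exact h2.trans h
  set Φ : ℝ → (ℝ → ℝ) → ℝ → ℝ := fun η F t => G F (max 0 (min (t - η) T)) with hΦ
  have hΦmem : ∀ η F, IsCandidate ωd A T F₀ F → IsCandidate ωd A T F₀ (Φ η F) := by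
    intro η F hF
    refine ⟨fun t => tsum_nonneg fun k => by positivity, fun s t => ?_, fun t => ?_⟩
    · refine (hGmod F hF _ (hclamp _) _ (hclamp _)).trans ?_
      have h1 : |max 0 (min (s - η) T) - max 0 (min (t - η) T)| ≤ |s - t| :=
        (hclampsub (s - η) (t - η)).trans_eq (by rw [sub_sub_sub_cancel_right])
      have := hωd.mono (abs_nonneg _) h1
      gcongr
    · rw [← hG0 F hF]
      refine (hGmod F hF _ (hclamp _) _ ⟨le_rfl, hT0.le⟩).trans ?_
      have h := hclamp (t - η)
      have := hωd.mono (abs_nonneg _) (x := |max 0 (min (t - η) T) - 0|) (y := T)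
        (by rw [sub_zero, abs_of_nonneg h.1]; exact h.2)
      gcongr
  have hconst : IsCandidate ωd A T F₀ fun _ => F₀ := by
    refine ⟨fun _ => hF₀, fun s t => ?_, fun t => ?_⟩ <;> rw [sub_self, abs_zero]
    · exact mul_nonneg hA.le (hωd.nonneg (abs_nonneg _))
    · exact mul_nonneg hA.le (hωd.nonneg hT0.le)
  have hiter : ∀ (η : ℝ) (j : ℕ), IsCandidate ωd A T F₀ ((Φ η)^[j] fun _ => F₀) := by
    intro η j
    induction j with
    | zero => exact hconst
    | succ j ih => rw [Function.iterate_succ_apply']; exact hΦmem η _ ih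
  have hstat : ∀ η : ℝ, 0 < η → ∀ j : ℕ, ∀ t : ℝ, t ≤ (j + 1) * η →
      ((Φ η)^[j + 1] fun _ => F₀) t = ((Φ η)^[j] fun _ => F₀) t := by
    intro η hη j
    induction j with
    | zero =>
      intro t ht
      have : max 0 (min (t - η) T) = 0 := max_eq_left ((min_le_left _ _).trans (by
        norm_num at ht; linarith))
      simp only [zero_add, Function.iterate_one, Function.iterate_zero, id, hΦ, this]
      exact hG0 _ hconst
    | succ j ih =>
      intro t ht
      rw [Function.iterate_succ_apply', Function.iterate_succ_apply' (Φ η) j]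
      push_cast at ht
      have hpos : 0 ≤ ((j : ℝ) + 1) * η := by positivity
      refine hcausal _ _ (hiter η j) (by
          rw [← Function.iterate_succ_apply' (Φ η) j]; exact hiter η (j + 1))
        (min ((j + 1) * η) T) (min_le_right _ _) (fun r hr => ?_) _ ⟨(hclamp _).1, ?_⟩
      · rw [← Function.iterate_succ_apply' (Φ η) j]
        exact ih r (hr.2.trans (min_le_left _ _))
      · refine max_le (le_min hpos hT0.le) (min_le_min ?_ le_rfl)
        linarith
  set H : ℕ → ℝ → ℝ := fun n => (Φ (T / (n + 1)))^[n] fun _ => F₀ with hH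
  have hHmem : ∀ n, IsCandidate ωd A T F₀ (H n) := fun n => hiter _ n
  have hHapprox : ∀ n : ℕ, ∀ t ∈ Icc 0 T, |H n t - G (H n) t| ≤ A * ωd |T / ((n : ℝ) + 1)| := by
    intro n t ht
    have hn : (0 : ℝ) < n + 1 := by positivity
    have hη : 0 < T / ((n : ℝ) + 1) := div_pos hT0 hn
    have h1 := hstat _ hη n t (by rw [mul_div_cancel₀ _ hn.ne']; exact ht.2)
    rw [Function.iterate_succ_apply'] at h1
    change Φ (T / (n + 1)) (H n) t = H n t at h1
    rw [← h1]
    refine (hGmod _ (hHmem n) _ (hclamp _) t ht).trans ?_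
    have h2 := hclampsub (t - T / (n + 1)) t
    rw [min_eq_left ht.2, max_eq_right ht.1, sub_sub_cancel_left, abs_neg] at h2
    have := hωd.mono (abs_nonneg _) h2
    gcongr
  -- compactness
  let 𝒰 : Ultrafilter ℕ := hyperfilter ℕ
  have h𝒰 : (𝒰 : Filter ℕ) ≤ atTop := Nat.hyperfilter_le_atTop
  have hlim : ∀ t, ∃ x, Tendsto (fun n => H n t) 𝒰 (𝓝 x) := by
    intro t
    have hmem : ∀ n, H n t ∈ Metric.closedBall F₀ (A * ωd T) := fun n =>
      (hHmem n).abs_sub_init_le t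
    obtain ⟨x, -, hx⟩ := (isCompact_closedBall F₀ (A * ωd T)).ultrafilter_le_nhds'
      (𝒰.map fun n => H n t) (Filter.mem_map.2 (univ_mem' hmem))
    exact ⟨x, hx⟩
  choose F hF using hlim
  have hFmem : IsCandidate ωd A T F₀ F := by
    refine ⟨fun t => ge_of_tendsto' (hF t) fun n => (hHmem n).nonneg t, fun s t => ?_, fun t => ?_⟩
    · exact le_of_tendsto' ((hF s).sub (hF t)).abs fun n => (hHmem n).abs_sub_le s t
    · exact le_of_tendsto' ((hF t).sub_const F₀).abs fun n => (hHmem n).abs_sub_init_le t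
  have hUlim : ∀ k, ∀ t ∈ Icc 0 T, Tendsto (fun n => U (H n) k t) 𝒰 (𝓝 (U F k t)) := by
    intro k t ht
    obtain ⟨D, hD0, hD⟩ := hdep F hFmem k
    rw [tendsto_iff_dist_tendsto_zero]
    have hsq : Tendsto (fun n => (U (H n) k t - U F k t) ^ 2) 𝒰 (𝓝 0) := by
      rw [Metric.tendsto_nhds]
      intro ρ hρ
      have h1 : Tendsto (fun x => D * ωm x ^ 2) (𝓝[>] 0) (𝓝 0) := by
        simpa using (hωm.tendsto_zero.pow 2).const_mul D
      obtain ⟨ε, hε1, hε : 0 < ε⟩ := ((h1.eventually (gt_mem_nhds hρ)).and self_mem_nhdsWithin).exists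
      filter_upwards [IsCandidate.eventually_dist_lt hωd hHmem hF hε] with n hn
      rw [Real.dist_eq, sub_zero, abs_of_nonneg (sq_nonneg _)]
      exact (hD _ (hHmem n) T le_rfl ε (fun r hr => (hn r hr).le) t ht).trans_lt hε1
    have := hsq.sqrt
    simpa [Real.sqrt_sq_eq_abs, Real.dist_eq] using this
  have hGlim : ∀ t ∈ Icc 0 T, Tendsto (fun n => G (H n) t) 𝒰 (𝓝 (G F t)) := by
    intro t ht
    refine tendsto_tsum_of_dominated_convergence ((hV.2.2.1.add hV.2.1).mul_left K)
      (fun k => ((hUlim k t ht).pow 2).const_mul _) (Eventually.of_forall fun n k => ?_)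
    rw [Real.norm_eq_abs, abs_of_nonneg (by positivity)]
    exact (le_add_of_nonneg_left (sq_nonneg _)).trans
      (hctrl _ (hHmem n) k _ _ _ _ (hUV _ (hHmem n) k) t ht)
  refine ⟨F, hFmem, U F, V F, hUV F hFmem, fun t ht => ?_⟩
  have hdiff : Tendsto (fun n => H n t - G (H n) t) 𝒰 (𝓝 0) := by
    refine squeeze_zero_norm (fun n => hHapprox n t ht) ?_
    have h1 : Tendsto (fun n : ℕ => T / ((n : ℝ) + 1)) 𝒰 (𝓝 0) :=
      ((tendsto_const_div_atTop_nhds_zero_nat T).comp (tendsto_add_atTop_nat 1)).mono_left h𝒰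
        |>.congr fun n => by simp
    have hcont : Continuous fun x : ℝ => A * ωd |x| :=
      continuous_const.mul (hωd.continuous_comp_abs continuous_id)
    simpa [hωd.zero, Function.comp_def] using (hcont.tendsto 0).comp h1
  have := tendsto_nhds_unique hdiff ((hF t).sub (hGlim t ht))
  exact sub_eq_zero.1 this.symm

namespace IsModeSol

variable {c : ℝ → ℝ} {b l p q T : ℝ} {u v : ℝ → ℝ}

lemma derivWithin_u (h : IsModeSol c b l p q u v) (hT0 : 0 < T) (hT1 : T ≤ 1) {t : ℝ}
    (ht : t ∈ Icc 0 T) : derivWithin u (Icc 0 T) t = v t :=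
  (h.hasDerivAt_u t ⟨ht.1, ht.2.trans hT1⟩).hasDerivWithinAt.derivWithin
    (uniqueDiffOn_Icc hT0 t ht)

lemma derivWithin_derivWithin_u (h : IsModeSol c b l p q u v) (hT0 : 0 < T) (hT1 : T ≤ 1) {t : ℝ}
    (ht : t ∈ Icc 0 T) :
    derivWithin (derivWithin u (Icc 0 T)) (Icc 0 T) t = -(b * v t) - c t * l ^ 2 * u t :=
  ((h.hasDerivAt_v t ⟨ht.1, ht.2.trans hT1⟩).hasDerivWithinAt.congr
    (fun _ hs => h.derivWithin_u hT0 hT1 hs) (h.derivWithin_u hT0 hT1 ht)).derivWithin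
    (uniqueDiffOn_Icc hT0 t ht)

lemma contDiffOn_u (h : IsModeSol c b l p q u v) (hc : Continuous c) (hT0 : 0 < T) (hT1 : T ≤ 1) :
    ContDiffOn ℝ 2 u (Icc 0 T) := by
  have hsub : Icc 0 T ⊆ Icc (0 : ℝ) 1 := Icc_subset_Icc_right hT1
  have hI : UniqueDiffOn ℝ (Icc 0 T) := uniqueDiffOn_Icc hT0
  have hv : ContDiffOn ℝ 1 v (Icc 0 T) := by
    rw [show (1 : WithTop ℕ∞) = 0 + 1 by norm_num, contDiffOn_succ_iff_derivWithin hI]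
    refine ⟨fun t ht => (h.hasDerivAt_v t (hsub ht)).differentiableAt.differentiableWithinAt,
      by simp, contDiffOn_zero.2 ?_⟩
    have hcont : ContinuousOn (fun t => -(b * v t) - c t * l ^ 2 * u t) (Icc 0 T) :=
      (((h.continuousOn_v.mono hsub).const_mul b).neg).sub
        ((hc.continuousOn.mul continuousOn_const).mul (h.continuousOn_u.mono hsub))
    exact hcont.congr fun t ht =>
      (h.hasDerivAt_v t (hsub ht)).hasDerivWithinAt.derivWithin (hI t ht)
  rw [show (2 : WithTop ℕ∞) = 1 + 1 by norm_num, contDiffOn_succ_iff_derivWithin hI]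
  exact ⟨fun t ht => (h.hasDerivAt_u t (hsub ht)).differentiableAt.differentiableWithinAt,
    by simp, hv.congr fun t ht => h.derivWithin_u hT0 hT1 ht⟩

lemma sq_le_of_sq_deriv_le (h : IsModeSol c b l p q u v) (hT1 : T ≤ 1) {W : ℝ}
    (hv : ∀ t ∈ Icc 0 T, v t ^ 2 ≤ W) {t : ℝ} (ht : t ∈ Icc 0 T) :
    u t ^ 2 ≤ 2 * p ^ 2 + 2 * W := by
  have hW : 0 ≤ W := (sq_nonneg _).trans (hv t ht)
  have h0 : (0 : ℝ) ∈ Icc 0 T := ⟨le_rfl, ht.1.trans ht.2⟩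
  have h1 := (convex_Icc (0 : ℝ) T).norm_image_sub_le_of_norm_hasDerivWithin_le
    (fun s hs => (h.hasDerivAt_u s ⟨hs.1, hs.2.trans hT1⟩).hasDerivWithinAt)
    (fun s hs => Real.abs_le_sqrt (hv s hs)) h0 ht
  rw [h.u_zero, Real.norm_eq_abs, Real.norm_eq_abs, sub_zero, abs_of_nonneg ht.1] at h1
  have h2 : |u t - p| ≤ √W :=
    h1.trans (mul_le_of_le_one_right (Real.sqrt_nonneg _) (ht.2.trans hT1))
  have h3 : (u t - p) ^ 2 ≤ W := by
    rw [← sq_abs, ← Real.sq_sqrt hW]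
    gcongr
  nlinarith [sq_nonneg (u t - 2 * p)]

end IsModeSol

lemma Vsum_nonneg {ωd : ℝ → ℝ} (hd : IsModulus ωd) (lam u0 u1 : ℕ → ℝ) (k : ℕ) :
    0 ≤ Vsum lam ωd u0 u1 k := by
  rw [Vsum]
  split_ifs with h
  · have := hd.pos (one_div_pos.2 h)
    positivity
  · exact le_rfl

lemma Vsum_le_mul_Vsum {ωd : ℝ → ℝ} (hd : IsModulus ωd) {lam u0 u1 u v : ℕ → ℝ} {K : ℝ} {k : ℕ}
    (h : v k ^ 2 + lam k ^ 2 * u k ^ 2 ≤ K * (u1 k ^ 2 + lam k ^ 2 * u0 k ^ 2)) :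
    Vsum lam ωd u v k ≤ K * Vsum lam ωd u0 u1 k := by
  rw [Vsum, Vsum]
  split_ifs with hk
  · have := hd.pos (one_div_pos.2 hk)
    rw [← mul_div_assoc]
    gcongr
  · simp

lemma sq_weighted_le_Vsum {ωd : ℝ → ℝ} (hd : IsModulus ωd) {lam u v : ℕ → ℝ} {k : ℕ} {x : ℝ}
    (hx : x ^ 2 ≤ v k ^ 2 + lam k ^ 2 * u k ^ 2) :
    (if 0 < lam k then x / √(ωd (1 / lam k)) else 0) ^ 2 ≤ Vsum lam ωd u v k := by
  rw [Vsum]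
  split_ifs with hk
  · have := hd.pos (one_div_pos.2 hk)
    rw [div_pow, Real.sq_sqrt this.le]
    gcongr
  · simp

/-- Subcritical dissipation: local existence in the interpolation space `V_{ωd}` for
the Kirchhoff equation with strong damping `A^σ u'`, `σ ∈ (0,1/2]`, when the modulus
`ωd` is compatible with `α` and the modulus of `m` satisfies the `(α,σ)` condition. -/
theorem local_existence_subcritical_interpolation
    (lam : ℕ → ℝ) (hlam : ∀ k, 0 ≤ lam k)
    (μ₁ : ℝ) (hμ₁ : 0 < μ₁)
    (m : ℝ → ℝ) (hmlb : ∀ x : ℝ, 0 ≤ x → μ₁ ≤ m x)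
    (ωm : ℝ → ℝ) (hωm : IsModulus ωm)
    (hmc : ∀ a b : ℝ, 0 ≤ a → 0 ≤ b → |m a - m b| ≤ ωm |a - b|)
    (σ δ : ℝ) (hσ0 : 0 < σ) (hσ : σ ≤ 1 / 2) (hδ : 0 < δ)
    (α : ℝ) (hα0 : 0 ≤ α) (hα1 : α < 1 / 4)
    (hlimsup : ∃ C : ℝ, ∀ᶠ x in 𝓝[>] (0:ℝ), ωm x ^ (4 * α) / x ^ (1 - 2 * σ) ≤ C)
    (ωd : ℝ → ℝ) (hωd : IsModulus ωd) (hωd1 : ωd 1 = 1)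
    (hωdle : ∀ x : ℝ, 0 ≤ x → ωd x ≤ x ^ (4 * α))
    (hωdlim : Tendsto (fun x => ωd x / x ^ (4 * α)) (𝓝[>] (0:ℝ)) (𝓝 0))
    (u0 u1 : ℕ → ℝ) (hV : MemV lam ωd u0 u1) :
    ∃ T : ℝ, 0 < T ∧ ∃ u : ℕ → ℝ → ℝ,
      IsKirchhoffSol lam m σ δ (Icc 0 T) u0 u1 u ∧
      VRegCurves lam ωd (Icc 0 T) u := by
  set F₀ := ∑' k, lam k ^ 2 * u0 k ^ 2
  have hF₀ : 0 ≤ F₀ := tsum_nonneg fun k => by positivity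
  obtain ⟨K, hK, hctrl⟩ :=
    exists_energy_control hlam hμ₁ hmlb hωm hmc hσ hδ hα0 hlimsup hωd hωdlim hF₀
  have hS : 0 ≤ ∑' k, Vsum lam ωd u0 u1 k := tsum_nonneg (Vsum_nonneg hωd lam u0 u1)
  have hA : 0 < K * (∑' k, Vsum lam ωd u0 u1 k) + 1 := by positivity
  obtain ⟨T, hT0, hT1, hT⟩ := hctrl _ hA
  obtain ⟨F, hF, u, v, huv, hFG⟩ := exists_selfConsistent
    (b := fun k => 2 * δ * lam k ^ (2 * σ)) hlam
    (fun k => mul_nonneg (by positivity) (Real.rpow_nonneg (hlam k) _)) hωm hmc hωd hV hA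
    (le_add_of_nonneg_right zero_le_one) hT0 hT1 fun F hF k p q u v h => hT F hF k p q u v h
  have hsub : Icc 0 T ⊆ Icc (0 : ℝ) 1 := Icc_subset_Icc_right hT1
  have hmF : Continuous fun t => m (F t) := hF.continuous_comp hωm hωd hA.le hmc
  have henergy : ∀ t ∈ Icc 0 T, ∀ k, v k t ^ 2 + lam k ^ 2 * u k t ^ 2 ≤
      K * (u1 k ^ 2 + lam k ^ 2 * u0 k ^ 2) := fun t ht k => hT F hF k _ _ _ _ (huv k) t ht
  have hu : ∀ k, ContinuousOn (u k) (Icc 0 T) := fun k => (huv k).continuousOn_u.mono hsub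
  have hdu : ∀ k, ∀ t ∈ Icc 0 T, derivWithin (u k) (Icc 0 T) t = v k t :=
    fun k t ht => (huv k).derivWithin_u hT0 hT1 ht
  have hdcont : ∀ k, ContinuousOn (derivWithin (u k) (Icc 0 T)) (Icc 0 T) :=
    fun k => ((huv k).continuousOn_v.mono hsub).congr (hdu k)
  have hE : Summable fun k => K * (u1 k ^ 2 + lam k ^ 2 * u0 k ^ 2) :=
    (hV.2.2.1.add hV.2.1).mul_left K
  have hVt : ∀ t ∈ Icc 0 T, ∀ k,
      Vsum lam ωd (fun k => u k t) (fun k => derivWithin (u k) (Icc 0 T) t) k ≤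
        K * Vsum lam ωd u0 u1 k := fun t ht k =>
    Vsum_le_mul_Vsum hωd (by simpa only [hdu k t ht] using henergy t ht k)
  have hVK : Summable fun k => K * Vsum lam ωd u0 u1 k := hV.2.2.2.mul_left K
  refine ⟨T, hT0, u, ⟨fun k => (huv k).contDiffOn_u hmF hT0 hT1, fun k => (huv k).u_zero,
    fun k => ?_, fun k t ht => ?_, ?_, ?_, ?_⟩, fun t ht => ?_, ?_, ?_⟩
  · rw [hdu k 0 ⟨le_rfl, hT0.le⟩, (huv k).v_zero]
  · have hFt : ∑' j, lam j ^ 2 * u j t ^ 2 = F t := (hFG t ht).symm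
    rw [(huv k).derivWithin_derivWithin_u hT0 hT1 ht, hdu k t ht, hFt]
    ring
  · refine l2Cont_of_dominated ((hV.1.mul_left 2).add (hE.mul_left 2)) (fun t ht k => ?_) hu
    exact (huv k).sq_le_of_sq_deriv_le hT1 (fun s hs =>
      (le_add_of_nonneg_right (by positivity)).trans (henergy s hs k)) ht
  · refine l2Cont_of_dominated hE (fun t ht k => ?_) fun k => (hu k).const_mul _
    rw [mul_pow]
    exact (le_add_of_nonneg_left (sq_nonneg _)).trans (henergy t ht k)
  · refine l2Cont_of_dominated hE (fun t ht k => ?_) hdcont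
    rw [hdu k t ht]
    exact (le_add_of_nonneg_right (by positivity)).trans (henergy t ht k)
  · exact Summable.of_nonneg_of_le (Vsum_nonneg hωd _ _ _) (hVt t ht) hVK
  · refine l2Cont_of_dominated hVK (fun t ht k => ?_) fun k => ?_
    · refine (sq_weighted_le_Vsum hωd ?_).trans (hVt t ht k)
      rw [mul_pow]
      exact le_add_of_nonneg_left (sq_nonneg _)
    · split_ifs
      · exact ((hu k).const_mul _).div_const _
      · exact continuousOn_const
  · refine l2Cont_of_dominated hVK (fun t ht k => ?_) fun k => ?_
    · exact (sq_weighted_le_Vsum hωd (le_add_of_nonneg_right (by positivity))).trans (hVt t ht k)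
    · split_ifs
      · exact (hdcont k).div_const _
      · exact continuousOn_const
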